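/- Let M be a nonempty finite index set, let w : M → ℝ satisfy w_m ≥ 0 for all m and Σ_{m} w_m = 1, and let v : M → ℝ satisfy v_m > 0 for all m. Define the mixture density q : ℂ → ℝ by q(z) = Σ_{m} w_m · (π v_m)⁻¹ · exp(−‖z‖²/v_m). Then the differential entropy of q is at most that of the complex Gaussian with the same variance: −∫_ℂ q(z) · log(q(z)) dz ≤ log(π e · Σ_{m} w_m v_m). -/

import Mathlib

open MeasureTheory Real

lemma aux_int_zero {s : ℝ} (hs : 0 < s) :
    ∫ z : ℂ, (π * s)⁻¹ * Real.exp (-‖z‖ ^ 2 / s) = 1 := by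
  have h := Complex.integral_rpow_mul_exp_neg_mul_rpow (p := 2) (q := 0) (b := s⁻¹)
    (by norm_num) (by norm_num) (by positivity)
  rw [integral_const_mul]
  have e : (fun z : ℂ => Real.exp (-‖z‖ ^ 2 / s)) =
      fun z : ℂ => ‖z‖ ^ (0:ℝ) * rexp (-s⁻¹ * ‖z‖ ^ (2:ℝ)) := by
    funext z
    rw [Real.rpow_zero, one_mul, Real.rpow_two]
    congr 1
    ring
  rw [e, h]
  have h1 : (-(0 + 2) / 2 : ℝ) = -1 := by norm_num
  have h2 : ((0 + 2) / 2 : ℝ) = 1 := by norm_num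
  rw [h1, h2, Real.Gamma_one, Real.rpow_neg_one]
  have := Real.pi_pos
  field_simp

lemma aux_int_two {s : ℝ} (hs : 0 < s) :
    ∫ z : ℂ, ‖z‖ ^ 2 * ((π * s)⁻¹ * Real.exp (-‖z‖ ^ 2 / s)) = s := by
  have h := Complex.integral_rpow_mul_exp_neg_mul_rpow (p := 2) (q := 2) (b := s⁻¹)
    (by norm_num) (by norm_num) (by positivity)
  have e : (fun z : ℂ => ‖z‖ ^ 2 * ((π * s)⁻¹ * Real.exp (-‖z‖ ^ 2 / s))) =
      fun z : ℂ => (π * s)⁻¹ * (‖z‖ ^ (2:ℝ) * rexp (-s⁻¹ * ‖z‖ ^ (2:ℝ))) := by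
    funext z
    rw [Real.rpow_two, mul_left_comm]
    congr 3
    ring
  rw [e, integral_const_mul, h]
  have h1 : (-(2 + 2) / 2 : ℝ) = -(2:ℕ) := by norm_num
  have h2 : ((2 + 2) / 2 : ℝ) = 2 := by norm_num
  rw [h1, h2, Real.Gamma_two, Real.rpow_neg (by positivity), Real.rpow_natCast]
  have := Real.pi_pos
  field_simp

/-- The differential entropy of a finite mixture of circularly symmetric complex
Gaussian densities `q(z) = Σ_m w_m (π v_m)⁻¹ exp(−‖z‖²/v_m)` (weights `w_m ≥ 0`
summing to `1`, variances `v_m > 0`) is at most that of the complex Gaussian with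
the same variance: `−∫_ℂ q log q ≤ log(π e Σ_m w_m v_m)`. -/
theorem mixture_entropy_le_gaussian
    {M : Type*} [Fintype M] [Nonempty M]
    (w v : M → ℝ) (hw : ∀ m, 0 ≤ w m) (hsum : ∑ m, w m = 1)
    (hv : ∀ m, 0 < v m) :
    -∫ z : ℂ, (∑ m, w m * (π * v m)⁻¹ * Real.exp (-‖z‖ ^ 2 / v m))
        * Real.log (∑ m, w m * (π * v m)⁻¹ * Real.exp (-‖z‖ ^ 2 / v m))
      ≤ Real.log (π * Real.exp 1 * ∑ m, w m * v m) := by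
  have hpi := Real.pi_pos
  obtain ⟨m₀, hm₀⟩ : ∃ m, 0 < w m := by
    by_contra! h
    have : ∑ m, w m ≤ 0 := Finset.sum_nonpos fun m _ => h m
    linarith
  set S := ∑ m, w m * v m with hS
  have hSpos : 0 < S := Finset.sum_pos' (fun m _ => mul_nonneg (hw m) (hv m).le)
    ⟨m₀, Finset.mem_univ _, mul_pos hm₀ (hv m₀)⟩
  set q : ℂ → ℝ := fun z => ∑ m, w m * (π * v m)⁻¹ * Real.exp (-‖z‖ ^ 2 / v m) with hq
  change -∫ z : ℂ, q z * Real.log (q z) ≤ _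
  have hqpos : ∀ z, 0 < q z := fun z => Finset.sum_pos'
    (fun m _ => by have := hw m; have := hv m; positivity)
    ⟨m₀, Finset.mem_univ _, by have := hv m₀; positivity⟩
  set C := ∑ m, w m * (π * v m)⁻¹ with hC
  have hqC : ∀ z, q z ≤ C := fun z => Finset.sum_le_sum fun m _ => by
    have := hw m
    have := hv m
    refine mul_le_of_le_one_right (by positivity) (Real.exp_le_one_iff.2 ?_)
    rw [neg_div]
    have : 0 ≤ ‖z‖ ^ 2 / v m := by positivity
    linarith
  set g : ℂ → ℝ := fun z => (π * S)⁻¹ * Real.exp (-‖z‖ ^ 2 / S) with hg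
  have i0 : ∀ {s : ℝ}, 0 < s →
      Integrable (fun z : ℂ => (π * s)⁻¹ * Real.exp (-‖z‖ ^ 2 / s)) := fun hs =>
    Integrable.of_integral_ne_zero (by rw [aux_int_zero hs]; exact one_ne_zero)
  have i2 : ∀ {s : ℝ}, 0 < s →
      Integrable (fun z : ℂ => ‖z‖ ^ 2 * ((π * s)⁻¹ * Real.exp (-‖z‖ ^ 2 / s))) := fun hs =>
    Integrable.of_integral_ne_zero (by rw [aux_int_two hs]; exact hs.ne')
  have eq0 : q = fun z => ∑ m, w m * ((π * v m)⁻¹ * Real.exp (-‖z‖ ^ 2 / v m)) := by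
    funext z; simp only [hq, mul_assoc]
  have eq2 : (fun z => ‖z‖ ^ 2 * q z) =
      fun z => ∑ m, w m * (‖z‖ ^ 2 * ((π * v m)⁻¹ * Real.exp (-‖z‖ ^ 2 / v m))) := by
    funext z; rw [eq0, Finset.mul_sum]
    exact Finset.sum_congr rfl fun m _ => by ring
  have iq : Integrable q := by
    rw [eq0]; exact integrable_finsetSum _ fun m _ => (i0 (hv m)).const_mul _
  have iq2 : Integrable (fun z => ‖z‖ ^ 2 * q z) := by
    rw [eq2]; exact integrable_finsetSum _ fun m _ => (i2 (hv m)).const_mul _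
  have Iq : ∫ z, q z = 1 := by
    rw [eq0, integral_finsetSum _ fun m _ => (i0 (hv m)).const_mul _]
    rw [← hsum]
    exact Finset.sum_congr rfl fun m _ => by
      rw [integral_const_mul, aux_int_zero (hv m), mul_one]
  have Iq2 : ∫ z, ‖z‖ ^ 2 * q z = S := by
    rw [eq2, integral_finsetSum _ fun m _ => (i2 (hv m)).const_mul _]
    simp_rw [integral_const_mul, aux_int_two (hv _)]
    rfl
  have ig : Integrable g := i0 hSpos
  have Ig : ∫ z, g z = 1 := aux_int_zero hSpos
  -- pointwise lower bound
  set L : ℂ → ℝ := fun z => (1 - Real.log (π * S)) * q z - S⁻¹ * (‖z‖ ^ 2 * q z) - g z with hL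
  have iL : Integrable L := ((iq.const_mul _).sub (iq2.const_mul _)).sub ig
  have IL : ∫ z, L z = -Real.log (π * S) - 1 := by
    have h1 : ∫ z, L z = (∫ z, ((1 - Real.log (π * S)) * q z - S⁻¹ * (‖z‖ ^ 2 * q z))) - ∫ z, g z :=
      integral_sub ((iq.const_mul _).sub (iq2.const_mul _)) ig
    rw [h1, integral_sub (iq.const_mul _) (iq2.const_mul _), integral_const_mul,
      integral_const_mul, Iq, Iq2, Ig, inv_mul_cancel₀ hSpos.ne']
    ring
  have hlow : ∀ z, L z ≤ q z * Real.log (q z) := fun z => by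
    have hgpos : 0 < g z := by simp only [hg]; positivity
    have hlg : Real.log (g z) = -Real.log (π * S) - S⁻¹ * ‖z‖ ^ 2 := by
      simp only [hg]
      rw [Real.log_mul (by positivity) (by positivity), Real.log_exp, Real.log_inv]
      ring
    have h := Real.log_le_sub_one_of_pos (div_pos hgpos (hqpos z))
    rw [Real.log_div hgpos.ne' (hqpos z).ne', hlg] at h
    have h' := mul_le_mul_of_nonneg_left h (hqpos z).le
    have e : q z * (g z / q z - 1) = g z - q z := by
      have := (hqpos z).ne'
      field_simp
    rw [e] at h'
    simp only [hL]
    linarith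
  have hup : ∀ z, q z * Real.log (q z) ≤ Real.log C * q z := fun z => by
    rw [mul_comm]
    exact mul_le_mul_of_nonneg_right (Real.log_le_log (hqpos z) (hqC z)) (hqpos z).le
  have hmeas : AEStronglyMeasurable (fun z => q z * Real.log (q z)) volume := by
    have : Measurable q := by simp only [hq]; fun_prop
    exact (this.mul this.log).aestronglyMeasurable
  have iqq : Integrable (fun z => q z * Real.log (q z)) :=
    integrable_of_le_of_le hmeas (Filter.Eventually.of_forall hlow)
      (Filter.Eventually.of_forall hup) iL (iq.const_mul _)
  have key := integral_mono iL iqq hlow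
  rw [IL] at key
  have : Real.log (π * Real.exp 1 * S) = Real.log (π * S) + 1 := by
    rw [mul_right_comm, Real.log_mul (by positivity) (by positivity), Real.log_exp]
  rw [this]
  linarith
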